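/- Let p be a probability measure on ℝ^D with finite first moment and let t ∈ (0,1). Then for every x ∈ ℝ^D, the posterior mean can be recovered from the score of the Gaussian-smoothed marginal: m_t^p(x) = x/t + ((1−t)²/t)·∇_x log p_t(x). (The posterior-mean–score identity of Equation (23).) -/

import Mathlib

open MeasureTheory Real Filter Topology

/-- The Gaussian kernel `G_t(x, y) = exp(−‖x − t·y‖²/(2(1−t)²))`. -/
noncomputable def gaussKernel {D : ℕ} (t : ℝ) (x y : EuclideanSpace ℝ (Fin D)) : ℝ :=
  Real.exp (-‖x - t • y‖ ^ 2 / (2 * (1 - t) ^ 2))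

/-- The posterior mean `m_t^p(x) = (∫ y·G_t(x,y) dp(y)) / (∫ G_t(x,y) dp(y))`. -/
noncomputable def postMean {D : ℕ} (p : Measure (EuclideanSpace ℝ (Fin D))) (t : ℝ)
    (x : EuclideanSpace ℝ (Fin D)) : EuclideanSpace ℝ (Fin D) :=
  (∫ y, gaussKernel t x y ∂p)⁻¹ • ∫ y, gaussKernel t x y • y ∂p

/-- The Gaussian-smoothed marginal density
`p_t(x) = (2π(1−t)²)^{−D/2} ∫ G_t(x,y) dp(y)`. -/
noncomputable def marginalDensity {D : ℕ} (p : Measure (EuclideanSpace ℝ (Fin D))) (t : ℝ)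
    (x : EuclideanSpace ℝ (Fin D)) : ℝ :=
  (2 * Real.pi * (1 - t) ^ 2) ^ (-(D : ℝ) / 2) * ∫ y, gaussKernel t x y ∂p

/-- The gradient of the Gaussian kernel in its first variable. -/
noncomputable def gaussKernelGrad {D : ℕ} (t : ℝ) (x y : EuclideanSpace ℝ (Fin D)) :
    EuclideanSpace ℝ (Fin D) :=
  ((1 - t) ^ 2)⁻¹ • (t • (gaussKernel t x y • y) - gaussKernel t x y • x)

section GaussKernel

variable {D : ℕ} (t : ℝ) (x y : EuclideanSpace ℝ (Fin D))

lemma gaussKernel_pos : 0 < gaussKernel t x y := Real.exp_pos _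

lemma gaussKernel_le_one : gaussKernel t x y ≤ 1 := by
  unfold gaussKernel
  rw [Real.exp_le_one_iff, neg_div, neg_nonpos]
  positivity

lemma norm_gaussKernel_le_one : ‖gaussKernel t x y‖ ≤ 1 := by
  rw [Real.norm_of_nonneg (gaussKernel_pos t x y).le]
  exact gaussKernel_le_one t x y

lemma continuous_gaussKernel : Continuous (fun y => gaussKernel t x y) := by
  unfold gaussKernel
  fun_prop

lemma continuous_gaussKernelGrad : Continuous (fun y => gaussKernelGrad t x y) := by
  have := continuous_gaussKernel t x
  unfold gaussKernelGrad
  fun_prop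

lemma norm_gaussKernelGrad_le :
    ‖gaussKernelGrad t x y‖ ≤ ((1 - t) ^ 2)⁻¹ * (|t| * ‖y‖ + ‖x‖) := by
  have hG := norm_gaussKernel_le_one t x y
  unfold gaussKernelGrad
  rw [norm_smul, Real.norm_of_nonneg (by positivity : (0 : ℝ) ≤ ((1 - t) ^ 2)⁻¹)]
  refine mul_le_mul_of_nonneg_left ((norm_sub_le _ _).trans ?_) (by positivity)
  rw [norm_smul, norm_smul, norm_smul, Real.norm_eq_abs t]
  have h (z : EuclideanSpace ℝ (Fin D)) : ‖gaussKernel t x y‖ * ‖z‖ ≤ ‖z‖ :=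
    mul_le_of_le_one_left (norm_nonneg z) hG
  gcongr
  · exact h y
  · exact h x

lemma hasFDerivAt_gaussKernel :
    HasFDerivAt (fun x => gaussKernel t x y) (innerSL ℝ (gaussKernelGrad t x y)) x := by
  have h := (((hasFDerivAt_id x).sub_const (t • y)).norm_sq.neg.mul_const
    (2 * (1 - t) ^ 2)⁻¹).exp
  refine h.congr_fderiv ?_
  ext z
  simp [gaussKernelGrad, gaussKernel, div_eq_mul_inv]
  ring

end GaussKernel

section Integrals

variable {D : ℕ} {p : Measure (EuclideanSpace ℝ (Fin D))} (t : ℝ) (x : EuclideanSpace ℝ (Fin D))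

lemma integrable_gaussKernel_smul (hp : Integrable (fun y => ‖y‖) p) :
    Integrable (fun y => gaussKernel t x y • y) p := by
  refine hp.mono' ((continuous_gaussKernel t x).smul continuous_id).aestronglyMeasurable
    (ae_of_all _ fun y => ?_)
  rw [norm_smul]
  exact mul_le_of_le_one_left (norm_nonneg y) (norm_gaussKernel_le_one t x y)

variable [IsProbabilityMeasure p]

lemma integrable_gaussKernel : Integrable (fun y => gaussKernel t x y) p :=
  .of_bound (continuous_gaussKernel t x).aestronglyMeasurable 1
    (ae_of_all _ fun y => norm_gaussKernel_le_one t x y)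

lemma integral_gaussKernel_pos : 0 < ∫ y, gaussKernel t x y ∂p :=
  integral_exp_pos (integrable_gaussKernel t x)

lemma integral_gaussKernelGrad (hp : Integrable (fun y => ‖y‖) p) :
    ∫ y, gaussKernelGrad t x y ∂p = ((1 - t) ^ 2)⁻¹ •
      (t • (∫ y, gaussKernel t x y • y ∂p) - (∫ y, gaussKernel t x y ∂p) • x) := by
  unfold gaussKernelGrad
  rw [integral_smul, integral_sub (by exact (integrable_gaussKernel_smul t x hp).smul t)
    ((integrable_gaussKernel t x).smul_const x), integral_smul, integral_smul_const]

lemma integrable_gaussKernelGrad (hp : Integrable (fun y => ‖y‖) p) :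
    Integrable (fun y => gaussKernelGrad t x y) p :=
  (((integrable_gaussKernel_smul t x hp).smul t).sub
    ((integrable_gaussKernel t x).smul_const x)).smul ((1 - t) ^ 2)⁻¹

/-- Differentiation under the integral sign for the Gaussian-smoothed measure. -/
lemma hasFDerivAt_integral_gaussKernel (hp : Integrable (fun y => ‖y‖) p) :
    HasFDerivAt (fun x => ∫ y, gaussKernel t x y ∂p)
      (innerSL ℝ (∫ y, gaussKernelGrad t x y ∂p)) x := by
  have h := hasFDerivAt_integral_of_dominated_of_fderiv_le (μ := p)
    (F' := fun x y => innerSL ℝ (gaussKernelGrad t x y))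
    (bound := fun y => ((1 - t) ^ 2)⁻¹ * (|t| * ‖y‖ + (‖x‖ + 1)))
    (Metric.ball_mem_nhds x one_pos)
    (Eventually.of_forall fun x => (continuous_gaussKernel t x).aestronglyMeasurable)
    (integrable_gaussKernel t x)
    ((innerSL ℝ).continuous.comp (continuous_gaussKernelGrad t x)).aestronglyMeasurable
    (ae_of_all _ fun y z hz => ?_)
    (((hp.const_mul |t|).add (integrable_const _)).const_mul _)
    (ae_of_all _ fun y z _ => hasFDerivAt_gaussKernel t z y)
  · rwa [(innerSL ℝ).integral_comp_comm (integrable_gaussKernelGrad t x hp)] at h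
  · rw [innerSL_apply_norm]
    refine (norm_gaussKernelGrad_le t z y).trans ?_
    have hzx : ‖z‖ ≤ ‖x‖ + 1 := by
      have := norm_le_norm_add_norm_sub' z x
      have := mem_ball_iff_norm.mp hz
      linarith
    gcongr

lemma hasGradientAt_log_marginalDensity (hp : Integrable (fun y => ‖y‖) p) (ht : t ≠ 1) :
    HasGradientAt (fun x => Real.log (marginalDensity p t x))
      ((∫ y, gaussKernel t x y ∂p)⁻¹ • ∫ y, gaussKernelGrad t x y ∂p) x := by
  have hZ := integral_gaussKernel_pos (p := p) t x
  have hc : 0 < (2 * Real.pi * (1 - t) ^ 2) ^ (-(D : ℝ) / 2) := by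
    have : 1 - t ≠ 0 := sub_ne_zero.mpr ht.symm
    positivity
  have h := ((hasFDerivAt_integral_gaussKernel t x hp).const_mul
    ((2 * Real.pi * (1 - t) ^ 2) ^ (-(D : ℝ) / 2))).log (mul_pos hc hZ).ne'
  rw [hasGradientAt_iff_hasFDerivAt]
  refine h.congr_fderiv ?_
  ext z
  simp only [smul_apply, innerSL_apply_apply, smul_eq_mul,
    InnerProductSpace.toDual_apply_apply, real_inner_smul_left]
  field_simp

end Integrals

/-- The posterior-mean–score identity of Equation (23):
`m_t^p(x) = x/t + ((1−t)²/t)·∇_x log p_t(x)`. -/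
theorem postMean_eq_score
    (D : ℕ) (p : Measure (EuclideanSpace ℝ (Fin D))) [IsProbabilityMeasure p]
    (hp : Integrable (fun y => ‖y‖) p)
    (t : ℝ) (ht : t ∈ Set.Ioo (0 : ℝ) 1)
    (x : EuclideanSpace ℝ (Fin D)) :
    postMean p t x
      = t⁻¹ • x + ((1 - t) ^ 2 / t) •
          gradient (fun x' => Real.log (marginalDensity p t x')) x := by
  obtain ⟨ht0, ht1⟩ := ht
  have hZ := (integral_gaussKernel_pos (p := p) t x).ne'
  have hs : (1 - t) ^ 2 ≠ 0 := pow_ne_zero 2 (sub_ne_zero.mpr ht1.ne')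
  rw [(hasGradientAt_log_marginalDensity t x hp ht1.ne).gradient,
    integral_gaussKernelGrad t x hp, postMean]
  match_scalars <;> field_simp
  ring
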